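/- arXiv:1806.11132 — 2 statements merged into one kernel-verified Lean document; each statement's English description precedes it below -/
import Mathlib

section
/- Let G be an infinite FC-group with finitely many automorphism orbits. Then the center Z(G) is nontrivial. -/
/-- The number of automorphism orbits of a group `G`: the number of orbits of the
natural action of `Aut(G)` on `G`. -/
noncomputable def omegaOrbits (G : Type*) [Group G] : ℕ :=
  Nat.card (Quotient (MulAction.orbitRel (MulAut G) G))

/-- `G` is an FC-group: every element has a finite conjugacy class. -/
def IsFCGroup (G : Type*) [Group G] : Prop :=
  ∀ g : G, {h : G | IsConj g h}.Finite

/-- `G` has finitely many automorphism orbits. -/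
def HasFinitelyManyAutOrbits (G : Type*) [Group G] : Prop :=
  Finite (Quotient (MulAction.orbitRel (MulAut G) G))

/-- In an FC-group the centralizer of a finite set has finite index. -/
theorem IsFCGroup.finiteIndex_centralizer {G : Type*} [Group G] (hFC : IsFCGroup G)
    {T : Set G} (hT : T.Finite) : (Subgroup.centralizer T).FiniteIndex := by
  have hsingle : ∀ g : G, (Subgroup.centralizer {g}).FiniteIndex := by
    intro g
    have : Finite {h : G | IsConj g h} := hFC g
    let f : G ⧸ Subgroup.centralizer {g} → {h : G | IsConj g h} :=
      Quotient.lift (fun x => ⟨x * g * x⁻¹, isConj_iff.2 ⟨x, rfl⟩⟩) (by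
        intro x y hxy
        have h := Subgroup.mem_centralizer_singleton_iff.1 (QuotientGroup.leftRel_apply.1 hxy)
        apply Subtype.ext
        change x * g * x⁻¹ = y * g * y⁻¹
        rw [mul_inv_eq_iff_eq_mul]
        calc x * g = x * (g * (x⁻¹ * y)) * y⁻¹ * x := by group
          _ = y * g * y⁻¹ * x := by rw [← h]; group)
    have hf : Function.Injective f := by
      intro p q
      induction p using QuotientGroup.induction_on with | H x => ?_
      induction q using QuotientGroup.induction_on with | H y => ?_
      intro h
      have h' : x * g * x⁻¹ = y * g * y⁻¹ := congrArg Subtype.val h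
      rw [QuotientGroup.eq, Subgroup.mem_centralizer_singleton_iff]
      calc x⁻¹ * y * g = x⁻¹ * (y * g * y⁻¹) * y := by group
        _ = g * (x⁻¹ * y) := by rw [← h']; group
    have := Finite.of_injective f hf
    exact Subgroup.finiteIndex_of_finite_quotient
  have : Finite T := hT
  have heq : Subgroup.centralizer T = ⨅ t : T, Subgroup.centralizer {(t : G)} := by
    ext x
    simp [Subgroup.mem_iInf, Subgroup.mem_centralizer_iff]
  rw [heq]
  exact Subgroup.finiteIndex_iInf fun t => hsingle t

/-- Automorphisms preserve the size of conjugacy classes. -/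
theorem ncard_setOf_isConj_mulAut {G : Type*} [Group G] (φ : MulAut G) (g : G) :
    {h : G | IsConj (φ g) h}.ncard = {h : G | IsConj g h}.ncard := by
  have heq : {h : G | IsConj (φ g) h} = φ '' {h : G | IsConj g h} := by
    ext h
    constructor
    · intro hh
      refine ⟨φ.symm h, ?_, φ.apply_symm_apply h⟩
      simpa using φ.symm.toMonoidHom.map_isConj hh
    · rintro ⟨k, hk, rfl⟩
      exact φ.toMonoidHom.map_isConj hk
  rw [heq, Set.ncard_image_of_injective _ φ.injective]

/-- With finitely many automorphism orbits, some conjugacy class has maximal size. -/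
theorem HasFinitelyManyAutOrbits.exists_ncard_le {G : Type*} [Group G]
    (hfin : HasFinitelyManyAutOrbits G) :
    ∃ a : G, ∀ g : G, {h : G | IsConj g h}.ncard ≤ {h : G | IsConj a h}.ncard := by
  have : Finite (Quotient (MulAction.orbitRel (MulAut G) G)) := hfin
  let f : Quotient (MulAction.orbitRel (MulAut G) G) → ℕ :=
    Quotient.lift (fun g => {h : G | IsConj g h}.ncard) (by
      rintro _ b ⟨φ, rfl⟩
      exact ncard_setOf_isConj_mulAut φ b)
  have : Nonempty (Quotient (MulAction.orbitRel (MulAut G) G)) := ⟨Quotient.mk _ 1⟩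
  obtain ⟨q, hq⟩ := Finite.exists_max f
  induction q using Quotient.inductionOn with | h a => ?_
  exact ⟨a, fun g => hq (Quotient.mk _ g)⟩

/-- An FC-group with trivial center and a conjugacy class of maximal size is finite. -/
theorem IsFCGroup.finite_of_center_eq_bot {G : Type*} [Group G] (hFC : IsFCGroup G) {a : G}
    (ha : ∀ g : G, {h : G | IsConj g h}.ncard ≤ {h : G | IsConj a h}.ncard)
    (hZ : Subgroup.center G = ⊥) : Finite G := by
  have hx : ∀ f : G, ∃ x : G, f ≠ 1 → x * f ≠ f * x := by
    intro f
    by_contra! hcon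
    obtain ⟨hf, -⟩ := hcon 1
    have hmem : f ∈ Subgroup.center G := Subgroup.mem_center_iff.2 fun x => (hcon x).2
    rw [hZ] at hmem
    exact hf (Subgroup.mem_bot.1 hmem)
  choose x hx using hx
  have hr : ∀ b : G, ∃ r : G, IsConj a b → r * a * r⁻¹ = b := by
    intro b
    by_cases hb : IsConj a b
    · obtain ⟨r, hr⟩ := isConj_iff.1 hb
      exact ⟨r, fun _ => hr⟩
    · exact ⟨1, fun h => absurd h hb⟩
  choose r hr using hr
  set K : Set G := {h : G | IsConj a h} with hK
  have hKfin : K.Finite := hFC a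
  set F : Set G := Set.image2 (fun b d => b * d⁻¹) K K with hF
  have hFfin : F.Finite := hKfin.image2 _ hKfin
  set C := Subgroup.centralizer (r '' K ∪ x '' F) with hC
  have : C.FiniteIndex :=
    hFC.finiteIndex_centralizer ((hKfin.image r).union (hFfin.image x))
  have hbot : C.normalCore = ⊥ := by
    rw [eq_bot_iff, ← hZ]
    intro c hc
    have hcC : ∀ t ∈ r '' K ∪ x '' F, t * c = c * t :=
      Subgroup.mem_centralizer_iff.1 (C.normalCore_le hc)
    have hsub : (fun b => c * b) '' K ⊆ {h : G | IsConj (c * a) h} := by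
      rintro _ ⟨b, hb, rfl⟩
      refine isConj_iff.2 ⟨r b, ?_⟩
      calc r b * (c * a) * (r b)⁻¹ = (r b * c) * a * (r b)⁻¹ := by group
        _ = c * (r b * a * (r b)⁻¹) := by
          rw [hcC _ (Or.inl ⟨b, hb, rfl⟩)]; group
        _ = c * b := by rw [hr b hb]
    have heq : (fun b => c * b) '' K = {h : G | IsConj (c * a) h} := by
      refine Set.eq_of_subset_of_ncard_le hsub ?_ (hFC _)
      rw [Set.ncard_image_of_injective _ (mul_right_injective c)]
      exact ha _
    refine Subgroup.mem_center_iff.2 fun y => ?_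
    have hy : y * (c * a) * y⁻¹ ∈ (fun b => c * b) '' K := by
      rw [heq]
      exact isConj_iff.2 ⟨y, rfl⟩
    obtain ⟨b, hb, hby⟩ := hy
    have hcomm : c⁻¹ * (y * c * y⁻¹) = b * (y * a * y⁻¹)⁻¹ := by
      have hb' : b = c⁻¹ * (y * (c * a) * y⁻¹) := by rw [← hby]; group
      rw [hb']; group
    have hmemF : c⁻¹ * (y * c * y⁻¹) ∈ F :=
      ⟨b, hb, y * a * y⁻¹, isConj_iff.2 ⟨y, rfl⟩, hcomm.symm⟩
    have hmemC : c⁻¹ * (y * c * y⁻¹) ∈ C :=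
      C.normalCore_le (mul_mem (inv_mem hc) (C.normalCore_normal.conj_mem c hc y))
    have hone : c⁻¹ * (y * c * y⁻¹) = 1 := by
      by_contra hne
      exact hx _ hne (Subgroup.mem_centralizer_iff.1 hmemC _ (Or.inr ⟨_, hmemF, rfl⟩))
    rwa [inv_mul_eq_one, eq_mul_inv_iff_mul_eq, eq_comm] at hone
  have hindex : (⊥ : Subgroup G).FiniteIndex := hbot ▸ inferInstance
  have hcard := hindex.index_ne_zero
  rw [Subgroup.index_bot] at hcard
  exact Nat.finite_of_card_ne_zero hcard

theorem stmt6 (G : Type*) [Group G] [Infinite G] (hFC : IsFCGroup G)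
    (hfin : HasFinitelyManyAutOrbits G) :
    Nontrivial (Subgroup.center G) := by
  rw [Subgroup.nontrivial_iff_ne_bot]
  intro hZ
  obtain ⟨a, ha⟩ := hfin.exists_ncard_le
  have := hFC.finite_of_center_eq_bot ha hZ
  exact not_finite G
end

section
/- Let G be an infinite non-abelian FC-group with finitely many automorphism orbits, and suppose G is a p-group. Then the exponent of G divides p^{ω(G)−2}. -/
section FCGroups

variable {G : Type*} [Group G]

theorem IsFCGroup.finiteIndex_centralizer_s12 (hFC : IsFCGroup G) {S : Set G} (hS : S.Finite) :
    (Subgroup.centralizer S).FiniteIndex := by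
  have h1 : ∀ x : G, (Subgroup.centralizer {x}).FiniteIndex := by
    intro x
    have : Finite {h : G | IsConj x h} := (hFC x).to_subtype
    have : Finite (G ⧸ Subgroup.centralizer {x}) := by
      refine Finite.of_injective
        (Quotient.lift (s := QuotientGroup.leftRel (Subgroup.centralizer {x}))
          (fun g => (⟨g * x * g⁻¹, isConj_iff.2 ⟨g, rfl⟩⟩ : {h : G | IsConj x h})) ?_) ?_
      · intro a b hab
        rw [← Quotient.eq_iff_equiv, Quotient.eq, QuotientGroup.leftRel_apply,
          Subgroup.mem_centralizer_singleton_iff] at hab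
        simp only [Subtype.mk.injEq]
        calc a * x * a⁻¹ = a * (x * (a⁻¹ * b)) * b⁻¹ := by group
          _ = a * ((a⁻¹ * b) * x) * b⁻¹ := by rw [hab]
          _ = b * x * b⁻¹ := by group
      · rintro ⟨a⟩ ⟨b⟩ hab
        have hab : a * x * a⁻¹ = b * x * b⁻¹ := congrArg Subtype.val hab
        refine Quotient.sound (QuotientGroup.leftRel_apply.2 ?_)
        rw [Subgroup.mem_centralizer_singleton_iff]
        calc a⁻¹ * b * x = a⁻¹ * (b * x * b⁻¹) * b := by group
          _ = x * (a⁻¹ * b) := by rw [← hab]; group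
    exact Subgroup.finiteIndex_of_finite_quotient
  have : Finite S := hS.to_subtype
  have h2 : (⨅ s : S, Subgroup.centralizer {(s : G)}).FiniteIndex :=
    Subgroup.finiteIndex_iInf fun s => h1 s
  refine Subgroup.finiteIndex_of_le (H := ⨅ s : S, Subgroup.centralizer {(s : G)}) ?_
  intro g hg s hs
  have := (Subgroup.mem_iInf.1 hg) ⟨s, hs⟩
  exact (Subgroup.mem_centralizer_singleton_iff.1 this).symm

theorem ncard_isConj_mulAut (φ : MulAut G) (g : G) :
    {h : G | IsConj (φ g) h}.ncard = {h : G | IsConj g h}.ncard := by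
  have : {h : G | IsConj (φ g) h} = φ '' {h : G | IsConj g h} := by
    ext h
    constructor
    · intro hh
      refine ⟨φ.symm h, ?_, φ.apply_symm_apply h⟩
      simpa using φ.symm.toMonoidHom.map_isConj hh
    · rintro ⟨k, hk, rfl⟩
      exact φ.toMonoidHom.map_isConj hk
  rw [this, Set.ncard_image_of_injective _ φ.injective]

theorem HasFinitelyManyAutOrbits.exists_max_ncard_isConj (hfin : HasFinitelyManyAutOrbits G) :
    ∃ a : G, ∀ g : G, {h : G | IsConj g h}.ncard ≤ {h : G | IsConj a h}.ncard := by
  have : Finite (Quotient (MulAction.orbitRel (MulAut G) G)) := hfin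
  have : Nonempty (Quotient (MulAction.orbitRel (MulAut G) G)) := ⟨Quotient.mk _ 1⟩
  obtain ⟨q, hq⟩ := Finite.exists_max
    fun q : Quotient (MulAction.orbitRel (MulAut G) G) => {h : G | IsConj q.out h}.ncard
  refine ⟨q.out, fun g => ?_⟩
  refine le_trans (le_of_eq ?_) (hq (Quotient.mk _ g))
  obtain ⟨φ, hφ⟩ := Quotient.exact (Quotient.out_eq
    (Quotient.mk (MulAction.orbitRel (MulAut G) G) g))
  rw [← hφ]
  exact (ncard_isConj_mulAut φ g).symm

open scoped Pointwise commutatorElement in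
/-- B. H. Neumann: an FC-group in which the sizes of the conjugacy classes have a maximum has
only finitely many commutators. -/
theorem IsFCGroup.finite_commutatorSet (hFC : IsFCGroup G)
    (hmax : ∃ a : G, ∀ g : G, {h : G | IsConj g h}.ncard ≤ {h : G | IsConj a h}.ncard) :
    (commutatorSet G).Finite := by
  obtain ⟨a, ha⟩ := hmax
  have hx : ∀ s : {h : G | IsConj a h}, ∃ c : G, c * a * c⁻¹ = s :=
    fun s => isConj_iff.1 s.2
  choose x hx using hx
  have : Finite {h : G | IsConj a h} := (hFC a).to_subtype
  set U := Subgroup.centralizer (Set.range x)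
  have hU : U.FiniteIndex := hFC.finiteIndex_centralizer_s12 (Set.finite_range x)
  have hconj : ∀ u ∈ U, (fun s => u * s) '' {h : G | IsConj a h} = {h : G | IsConj (u * a) h} := by
    intro u hu
    refine Set.eq_of_subset_of_ncard_le ?_ ?_ (hFC _)
    · rintro _ ⟨s, hs, rfl⟩
      refine isConj_iff.2 ⟨x ⟨s, hs⟩, ?_⟩
      have h1 : x ⟨s, hs⟩ * u = u * x ⟨s, hs⟩ := hu _ ⟨_, rfl⟩
      calc x ⟨s, hs⟩ * (u * a) * (x ⟨s, hs⟩)⁻¹ = (x ⟨s, hs⟩ * u) * a * (x ⟨s, hs⟩)⁻¹ := by group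
        _ = u * (x ⟨s, hs⟩ * a * (x ⟨s, hs⟩)⁻¹) := by rw [h1]; group
        _ = u * s := by rw [hx]
    · rw [Set.ncard_image_of_injective _ (mul_right_injective u)]
      exact ha _
  set A := {h : G | IsConj a h}
  have hA : A.Finite := hFC a
  have hUG : ∀ u ∈ U, ∀ g : G, ⁅u, g⁆ ∈ A * A⁻¹ := by
    intro u hu g
    have h1 : g * (u⁻¹ * a) * g⁻¹ ∈ {h : G | IsConj (u⁻¹ * a) h} := isConj_iff.2 ⟨g, rfl⟩
    rw [← hconj _ (U.inv_mem hu)] at h1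
    obtain ⟨s, hs, h2⟩ := h1
    refine ⟨s, hs, (g * a * g⁻¹)⁻¹, ?_, ?_⟩
    · exact Set.inv_mem_inv.2 (isConj_iff.2 ⟨g, rfl⟩)
    · have h3 : s = u * (g * (u⁻¹ * a) * g⁻¹) := by rw [← h2]; simp
      simp only [h3, commutatorElement_def]
      group
  have : Finite (G ⧸ U) := inferInstance
  have hT : ∀ t : G, {c : G | ∃ u g : G, c = u * ⁅t, g⁆ * u⁻¹}.Finite := by
    intro t
    have h1 : ((fun c => t * c) '' {h : G | IsConj t⁻¹ h}).Finite := (hFC _).image _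
    refine (h1.biUnion fun c _ => hFC c).subset ?_
    rintro _ ⟨u, g, rfl⟩
    refine Set.mem_biUnion (x := ⁅t, g⁆) ⟨g * t⁻¹ * g⁻¹, isConj_iff.2 ⟨g, rfl⟩, ?_⟩
      (isConj_iff.2 ⟨u, rfl⟩)
    simp only [commutatorElement_def]
    group
  refine ((Set.finite_iUnion fun q : G ⧸ U => hT q.out⁻¹).mul (hA.mul hA.inv)).subset ?_
  rintro _ ⟨y, g, rfl⟩
  set t := ((y⁻¹ : G) : G ⧸ U).out
  have ht : y * t ∈ U := by
    have : ((y⁻¹ : G) : G ⧸ U) = (t : G) := (QuotientGroup.out_eq' _).symm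
    simpa using QuotientGroup.eq.1 this
  refine Set.mem_mul.2 ⟨(y * t) * ⁅t⁻¹, g⁆ * (y * t)⁻¹,
    Set.mem_iUnion.2 ⟨_, y * t, g, rfl⟩, ⁅y * t, g⁆, hUG _ ht g, ?_⟩
  simp only [commutatorElement_def]
  group

theorem IsFCGroup.exists_infinite_commuting_set [Infinite G] (hFC : IsFCGroup G) :
    ∃ S : Set G, S.Infinite ∧ ∀ x ∈ S, ∀ y ∈ S, Commute x y := by
  obtain ⟨S, hS⟩ := zorn_subset {S : Set G | ∀ x ∈ S, ∀ y ∈ S, Commute x y} (by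
    intro c hc hchain
    refine ⟨⋃₀ c, ?_, fun s hs => Set.subset_sUnion_of_mem hs⟩
    rintro x ⟨s, hs, hxs⟩ y ⟨t, ht, hyt⟩
    rcases hchain.total hs ht with h | h
    · exact hc ht x (h hxs) y hyt
    · exact hc hs x hxs y (h hyt))
  refine ⟨S, fun hfin => ?_, hS.1⟩
  have hidx := hFC.finiteIndex_centralizer_s12 hfin
  have hinf : (Subgroup.centralizer S : Set G).Infinite := by
    intro h
    have : Finite (Subgroup.centralizer S) := h.to_subtype
    have hG : Finite G :=
      (Subgroup.finite_iff_finite_and_finiteIndex (Subgroup.centralizer S)).2 ⟨this, hidx⟩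
    exact not_finite G
  obtain ⟨x, hxC, hxS⟩ := (hinf.sdiff hfin).nonempty
  have hxC : ∀ s ∈ S, Commute s x := hxC
  refine hxS (hS.le_of_ge (y := insert x S) ?_ (Set.subset_insert x S) (Set.mem_insert x S))
  rintro y (rfl | hy) z (rfl | hz)
  · exact Commute.refl _
  · exact (hxC z hz).symm
  · exact hxC y hy
  · exact hS.1 y hy z hz

theorem finite_of_commuting_of_pow_eq_one {n : ℕ} (hn : {x : G | x ^ n = 1}.Finite) (k : ℕ)
    {S : Set G} (hcomm : ∀ x ∈ S, ∀ y ∈ S, Commute x y) (hS : ∀ x ∈ S, x ^ n ^ k = 1) :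
    S.Finite := by
  induction k generalizing S with
  | zero => exact (Set.finite_singleton 1).subset fun x hx => by simpa using hS x hx
  | succ k ih =>
    have himage : ((fun x => x ^ n) '' S).Finite := by
      refine ih ?_ ?_
      · rintro _ ⟨x, hx, rfl⟩ _ ⟨y, hy, rfl⟩
        exact (hcomm x hx y hy).pow_pow n n
      · rintro _ ⟨x, hx, rfl⟩
        simpa [← pow_mul, ← pow_succ'] using hS x hx
    refine Set.Finite.of_finite_fibers (fun x => x ^ n) himage ?_
    rintro _ ⟨y, hy, rfl⟩
    refine Set.Finite.of_finite_image (f := fun x => x * y⁻¹) (hn.subset ?_)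
      (mul_left_injective y⁻¹).injOn
    rintro _ ⟨x, ⟨hx, hxy⟩, rfl⟩
    have hxy : x ^ n = y ^ n := hxy
    change (x * y⁻¹) ^ n = 1
    rw [(hcomm x hx y hy).inv_right.mul_pow, hxy, inv_pow, mul_inv_cancel]

theorem IsFCGroup.infinite_setOf_pow_eq_one [Infinite G] (hFC : IsFCGroup G) {n k : ℕ}
    (h : ∀ g : G, g ^ n ^ k = 1) : {x : G | x ^ n = 1}.Infinite := fun hfin =>
  let ⟨_, hS, hcomm⟩ := hFC.exists_infinite_commuting_set
  hS (finite_of_commuting_of_pow_eq_one hfin k hcomm fun x _ => h x)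

theorem IsPGroup.exists_max_order {p : ℕ} (hp : p.Prime) (hpG : IsPGroup p G)
    (hfin : HasFinitelyManyAutOrbits G) :
    ∃ (e : ℕ) (g : G), orderOf g = p ^ e ∧ ∀ x : G, x ^ p ^ e = 1 := by
  have : Finite (Quotient (MulAction.orbitRel (MulAut G) G)) := hfin
  have : Nonempty (Quotient (MulAction.orbitRel (MulAut G) G)) := ⟨Quotient.mk _ 1⟩
  have : Fact p.Prime := ⟨hp⟩
  choose k hk using IsPGroup.iff_orderOf.1 hpG
  obtain ⟨q, hq⟩ := Finite.exists_max
    fun q : Quotient (MulAction.orbitRel (MulAut G) G) => k q.out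
  refine ⟨k q.out, q.out, hk _, fun x => ?_⟩
  obtain ⟨φ, hφ⟩ := Quotient.exact (Quotient.out_eq
    (Quotient.mk (MulAction.orbitRel (MulAut G) G) x))
  have hφ : φ x = (Quotient.mk (MulAction.orbitRel (MulAut G) G) x).out := hφ
  refine orderOf_dvd_iff_pow_eq_one.1 ?_
  rw [← MulEquiv.orderOf_eq φ x, hφ, hk]
  exact pow_dvd_pow p (hq _)

/-- Two elements of the same order in distinct automorphism orbits force one orbit more than
there are element orders. -/
theorem add_two_le_omegaOrbits (hfin : HasFinitelyManyAutOrbits G) {p e : ℕ} (hp : p.Prime)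
    {g y z : G} (hg : orderOf g = p ^ e) (hyz : orderOf y = orderOf z)
    (hne : ∀ φ : MulAut G, φ z ≠ y) : e + 2 ≤ omegaOrbits G := by
  classical
  have : Finite (Quotient (MulAction.orbitRel (MulAut G) G)) := hfin
  have := Fintype.ofFinite (Quotient (MulAction.orbitRel (MulAut G) G))
  let ord : Quotient (MulAction.orbitRel (MulAut G) G) → ℕ :=
    Quotient.lift orderOf fun a b ⟨φ, hφ⟩ => by
      rw [← hφ]
      exact MulEquiv.orderOf_eq φ b
  have hsub : (Finset.range (e + 1)).image (p ^ ·) ⊆ Finset.univ.image ord := by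
    intro m hm
    obtain ⟨i, hi, rfl⟩ := Finset.mem_image.1 hm
    refine Finset.mem_image.2 ⟨Quotient.mk _ (g ^ (orderOf g / p ^ i)), Finset.mem_univ _, ?_⟩
    refine orderOf_pow_orderOf_div ?_ ?_
    · rw [hg]
      exact pow_ne_zero _ hp.ne_zero
    · rw [hg]
      exact pow_dvd_pow p (Nat.lt_succ_iff.1 (Finset.mem_range.1 hi))
  have h1 := Finset.card_le_card hsub
  rw [Finset.card_image_of_injective _ (Nat.pow_right_injective hp.two_le),
    Finset.card_range] at h1
  have h2 : (Finset.univ.image ord).card <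
      (Finset.univ : Finset (Quotient (MulAction.orbitRel (MulAut G) G))).card := by
    refine lt_of_le_of_ne Finset.card_image_le fun heq => ?_
    have hinj := Finset.card_image_iff.1 heq
    rw [Finset.coe_univ, Set.injOn_univ] at hinj
    obtain ⟨φ, hφ⟩ := Quotient.exact (@hinj (Quotient.mk _ y) (Quotient.mk _ z) hyz)
    exact hne φ hφ
  rw [omegaOrbits, Nat.card_eq_fintype_card, ← Finset.card_univ]
  omega

open scoped commutatorElement in
theorem IsPGroup.exists_mem_commutator_orderOf_eq {p : ℕ} (hp : p.Prime) (hpG : IsPGroup p G)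
    (hna : ¬ ∀ a b : G, a * b = b * a) : ∃ z ∈ commutator G, orderOf z = p := by
  have : Fact p.Prime := ⟨hp⟩
  push Not at hna
  obtain ⟨a, b, hab⟩ := hna
  have hc : ⁅a, b⁆ ≠ 1 := fun h => hab (commutatorElement_eq_one_iff_mul_comm.1 h)
  have hcG : ⁅a, b⁆ ∈ commutator G :=
    Subgroup.commutator_mem_commutator (Subgroup.mem_top a) (Subgroup.mem_top b)
  obtain ⟨k, hk⟩ := IsPGroup.iff_orderOf.1 hpG ⁅a, b⁆
  have hk0 : k ≠ 0 := by
    rintro rfl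
    exact hc (orderOf_eq_one_iff.1 (by simpa using hk))
  refine ⟨⁅a, b⁆ ^ (orderOf ⁅a, b⁆ / p), pow_mem hcG _, orderOf_pow_orderOf_div ?_ ?_⟩
  · rw [hk]
    exact pow_ne_zero _ hp.ne_zero
  · rw [hk]
    exact dvd_pow_self p hk0

end FCGroups

theorem stmt12 (G : Type*) [Group G] [Infinite G] (hFC : IsFCGroup G)
    (hfin : HasFinitelyManyAutOrbits G) (p : ℕ) (hp : p.Prime) (hpG : IsPGroup p G)
    (hna : ¬ ∀ a b : G, a * b = b * a) :
    Monoid.exponent G ∣ p ^ (omegaOrbits G - 2) := by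
  have : Fact p.Prime := ⟨hp⟩
  obtain ⟨e, g, hg, he⟩ := hpG.exists_max_order hp hfin
  have : Finite (commutatorSet G) :=
    (hFC.finite_commutatorSet hfin.exists_max_ncard_isConj).to_subtype
  have hG' : Finite (commutator G) := inferInstance
  have hfinite : (commutator G : Set G).Finite := Set.finite_coe_iff.1 hG'
  obtain ⟨y, hy, hyG⟩ := ((hFC.infinite_setOf_pow_eq_one he).sdiff hfinite).nonempty
  have hy1 : y ≠ 1 := fun h => hyG (h ▸ (commutator G).one_mem)
  have hy' : orderOf y = p := orderOf_eq_prime hy hy1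
  obtain ⟨z, hzG, hz⟩ := hpG.exists_mem_commutator_orderOf_eq hp hna
  have hle : e + 2 ≤ omegaOrbits G := by
    refine add_two_le_omegaOrbits hfin hp hg (hy'.trans hz.symm) fun φ hφ => hyG ?_
    rw [← hφ]
    exact Subgroup.characteristic_iff_le_comap.1
      (inferInstance : (commutator G).Characteristic) φ hzG
  exact (Monoid.exponent_dvd_of_forall_pow_eq_one he).trans (pow_dvd_pow p (by omega))
end
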